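/- Flat Lifting Lemma: Let A° → B° be a flat R-algebra morphism with A° and B° both R-flat and topologically of finite type, and let f : Y° = Spec B° → X° = Spec A° denote the corresponding map of affine schemes. Let x° : Spec R → X° be an R-rational point of X° and let x̄ denote its reduction Spec K̄ → X°. Suppose there exists a K̄-rational point ȳ : Spec K̄ → Y° such that f ∘ ȳ = x̄. Then there exists an R-rational point y° : Spec R → Y° whose reduction is ȳ and such that f ∘ y° = x°. -/

import Mathlib

/-!  Prelude: rigid-analytic basics over a complete non-archimedean
algebraically closed field `K`. -/

open scoped BoundedContinuousFunction

noncomputable section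

namespace RigidQE

variable (K : Type) [NormedField K] [CompleteSpace K] [IsAlgClosed K] [IsUltrametricDist K]

/-- The valuation ring `R = {x : K | ‖x‖ ≤ 1}` of `K`. -/
def Ro : Subring K where
  carrier := {x | ‖x‖ ≤ 1}
  zero_mem' := by simp
  one_mem' := by simp
  add_mem' := fun {a b} ha hb => le_trans (IsUltrametricDist.norm_add_le_max a b) (max_le ha hb)
  neg_mem' := fun {a} ha => by simpa using ha
  mul_mem' := fun {a b} ha hb => le_trans (norm_mul_le a b)
    (by simpa using mul_le_one₀ ha (norm_nonneg b) hb)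

/-- The maximal ideal `℘ = {x : K | ‖x‖ < 1}` of the valuation ring. -/
def RoMax : Ideal (Ro K) where
  carrier := {x | ‖(x : K)‖ < 1}
  zero_mem' := by simp
  add_mem' := fun {a b} ha hb =>
    lt_of_le_of_lt (IsUltrametricDist.norm_add_le_max (a : K) (b : K)) (max_lt ha hb)
  smul_mem' := fun c x hx => by
    have h1 : ‖(c : K)‖ ≤ 1 := c.2
    have : ‖(c : K) * (x : K)‖ ≤ 1 * ‖(x : K)‖ := le_trans (norm_mul_le _ _) (by gcongr)
    simpa using lt_of_le_of_lt (by simpa using this) hx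

/-- The closed unit polydisc `R^m ⊆ K^m`. -/
def UnitBall (m : ℕ) : Set (Fin m → K) := {x | ∀ i, ‖x i‖ ≤ 1}

/-- The `i`-th coordinate function on the unit polydisc, as a bounded continuous function. -/
def coordFn (m : ℕ) (i : Fin m) : (UnitBall K m) →ᵇ K :=
  BoundedContinuousFunction.ofNormedAddCommGroup (fun x => x.1 i)
    ((continuous_apply i).comp continuous_subtype_val) 1 (fun x => x.2 i)

/-- The Tate algebra `K⟨S₁,…,Sₘ⟩` of strictly convergent power series, realised concretely
as the closure, with respect to the supremum norm, of the algebra of polynomial functions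
on the unit polydisc. -/
def TateAlg (m : ℕ) : Subalgebra K ((UnitBall K m) →ᵇ K) :=
  (Algebra.adjoin K (Set.range (coordFn K m))).topologicalClosure

end RigidQE

end

noncomputable section
namespace RigidQE

variable (K : Type) [NormedField K] [CompleteSpace K] [IsAlgClosed K] [IsUltrametricDist K]

/-- The projection `R^{m+N} → R^m` on the first `m` coordinates. -/
def ballProj (m N : ℕ) (z : UnitBall K (m + N)) : UnitBall K m :=
  ⟨fun i => z.1 (Fin.castAdd N i), fun i => z.2 _⟩

lemma ballProj_continuous (m N : ℕ) : Continuous (ballProj K m N) := by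
  apply Continuous.subtype_mk
  exact continuous_pi fun i => (continuous_apply _).comp continuous_subtype_val

/-- Pullback of bounded functions along the projection of polydiscs. -/
def ballPull (m N : ℕ) : ((UnitBall K m) →ᵇ K) →ₐ[K] ((UnitBall K (m + N)) →ᵇ K) where
  toFun f := f.compContinuous ⟨ballProj K m N, ballProj_continuous K m N⟩
  map_one' := by ext z; simp
  map_mul' f g := by ext z; simp
  map_zero' := by ext z; simp
  map_add' f g := by ext z; simp
  commutes' c := by ext z; simp

lemma ballPull_lipschitz (m N : ℕ) : LipschitzWith 1 (ballPull K m N) := by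
  apply LipschitzWith.of_dist_le_mul
  intro f g
  simp only [NNReal.coe_one, one_mul]
  refine (BoundedContinuousFunction.dist_le (dist_nonneg (x := f) (y := g))).2 ?_
  intro z
  exact BoundedContinuousFunction.dist_coe_le_dist (f := f) (g := g) (ballProj K m N z)

lemma ballPull_mem_TateAlg (m N : ℕ) {f : (UnitBall K m) →ᵇ K} (hf : f ∈ TateAlg K m) :
    ballPull K m N f ∈ TateAlg K (m + N) := by
  have hsub : (ballPull K m N) '' (Algebra.adjoin K (Set.range (coordFn K m)) : Set _)
      ⊆ (Algebra.adjoin K (Set.range (coordFn K (m + N))) : Set _) := by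
    rintro g ⟨g', hg', rfl⟩
    have : ballPull K m N g' ∈ (Algebra.adjoin K (Set.range (coordFn K m))).map
        (ballPull K m N) := Subalgebra.mem_map.2 ⟨g', hg', rfl⟩
    rw [AlgHom.map_adjoin] at this
    refine Algebra.adjoin_mono ?_ this
    rintro h ⟨h', ⟨i, rfl⟩, rfl⟩
    exact ⟨Fin.castAdd N i, by ext z; rfl⟩
  have := (image_closure_subset_closure_image (s := (Algebra.adjoin K (Set.range (coordFn K m)) :
      Set _)) (ballPull_lipschitz K m N).continuous) (Set.mem_image_of_mem _ hf)
  exact closure_mono hsub this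

/-- An affinoid variety, realised concretely as the zero locus, inside a closed unit
polydisc, of a set of strictly convergent power series. -/
structure Affinoid where
  m : ℕ
  carrier : Set (UnitBall K m)
  isZeroLocus : ∃ S : Set ((UnitBall K m) →ᵇ K),
    (∀ f ∈ S, f ∈ TateAlg K m) ∧ carrier = {x | ∀ f ∈ S, f x = 0}

variable {K}

/-- Restriction of (bounded continuous) functions on the polydisc to a subset, as plain
functions. -/
def resHom {m : ℕ} (Z : Set (UnitBall K m)) : ((UnitBall K m) →ᵇ K) →ₐ[K] (Z → K) where
  toFun f := fun z => f z.1
  map_one' := rfl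
  map_mul' f g := rfl
  map_zero' := rfl
  map_add' f g := rfl
  commutes' c := rfl

/-- The affinoid algebra of `X`, realised concretely as the algebra of functions on `X`
which are restrictions of strictly convergent power series.  (Since `K` is algebraically
closed, this faithfully represents the reduced affinoid algebra.) -/
def Affinoid.O (X : Affinoid K) : Subalgebra K (X.carrier → K) :=
  (TateAlg K X.m).map (resHom X.carrier)

/-- A basic semianalytic subset of an affinoid variety. -/
def IsBasicSemianalytic (X : Affinoid K) (S : Set X.carrier) : Prop :=
  ∃ (mm n : ℕ) (p q : Fin mm → X.O), n ≤ mm ∧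
    S = {x | (∀ i : Fin mm, (i : ℕ) < n → ‖(p i : X.carrier → K) x‖ ≤ ‖(q i : X.carrier → K) x‖)
      ∧ (∀ i : Fin mm, n ≤ (i : ℕ) → ‖(p i : X.carrier → K) x‖ < ‖(q i : X.carrier → K) x‖)}

/-- A semianalytic subset of an affinoid variety: a finite union of basic sets. -/
def IsSemianalytic (X : Affinoid K) (S : Set X.carrier) : Prop :=
  ∃ (k : ℕ) (B : Fin k → Set X.carrier),
    (∀ j, IsBasicSemianalytic X (B j)) ∧ S = ⋃ j, B j

variable (K)

/-- The product `X × R^N` of an affinoid variety with a closed unit polydisc. -/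
def Affinoid.prod (X : Affinoid K) (N : ℕ) : Affinoid K where
  m := X.m + N
  carrier := {z | ballProj K X.m N z ∈ X.carrier}
  isZeroLocus := by
    obtain ⟨S, hS, hXS⟩ := X.isZeroLocus
    refine ⟨(ballPull K X.m N) '' S, ?_, ?_⟩
    · rintro f ⟨f', hf', rfl⟩
      exact ballPull_mem_TateAlg K X.m N (hS f' hf')
    · ext z
      simp only [Set.mem_setOf_eq, hXS, Set.forall_mem_image]
      rfl

variable {K}

/-- The projection map `X × R^N → X` on points. -/
def Affinoid.projFun (X : Affinoid K) (N : ℕ) (z : (X.prod K N).carrier) : X.carrier :=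
  ⟨ballProj K X.m N z.1, z.2⟩

/-- A subanalytic subset of an affinoid variety: the image of a semianalytic subset of
`X × R^N` under the projection `X × R^N → X`. -/
def IsSubanalytic (X : Affinoid K) (S : Set X.carrier) : Prop :=
  ∃ (N : ℕ) (T : Set (X.prod K N).carrier),
    IsSemianalytic (X.prod K N) T ∧ S = (X.projFun N) '' T

end RigidQE
end

set_option synthInstance.maxHeartbeats 1000000
set_option maxHeartbeats 1000000

noncomputable section
namespace RigidQE

open scoped TensorProduct

variable (K : Type) [NormedField K] [CompleteSpace K] [IsAlgClosed K] [IsUltrametricDist K]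

/-- The ring `R⟨S₁,…,Sₘ⟩` of strictly convergent power series over the valuation ring
`R`: the strictly convergent power series of (Gauss = supremum) norm at most one, as an
`R`-subalgebra of the bounded continuous functions on the polydisc. -/
def TateAlgR (m : ℕ) : Subalgebra (Ro K) ((UnitBall K m) →ᵇ K) where
  carrier := {f | f ∈ TateAlg K m ∧ ‖f‖ ≤ 1}
  add_mem' := fun {f g} hf hg => ⟨add_mem hf.1 hg.1, by
    refine (BoundedContinuousFunction.norm_le zero_le_one).2 fun x => ?_
    have := IsUltrametricDist.norm_add_le_max (f x) (g x)
    refine le_trans (by simpa using this) (max_le ?_ ?_)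
    · exact le_trans (f.norm_coe_le_norm x) hf.2
    · exact le_trans (g.norm_coe_le_norm x) hg.2⟩
  mul_mem' := fun {f g} hf hg => ⟨mul_mem hf.1 hg.1,
    le_trans (norm_mul_le f g) (by simpa using mul_le_one₀ hf.2 (norm_nonneg g) hg.2)⟩
  algebraMap_mem' := fun r => by
    constructor
    · show algebraMap K _ (r : K) ∈ TateAlg K m
      exact Subalgebra.algebraMap_mem _ _
    · show ‖algebraMap K ((UnitBall K m) →ᵇ K) (r : K)‖ ≤ 1
      refine (BoundedContinuousFunction.norm_le zero_le_one).2 fun x => ?_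
      calc ‖(algebraMap K ((UnitBall K m) →ᵇ K) (r : K)) x‖ = ‖(r : K)‖ := by simp
      _ ≤ 1 := r.2

/-- An `R`-algebra is topologically of finite type if it is a homomorphic image of some
ring `R⟨S₁,…,Sₘ⟩` of strictly convergent power series over `R`. -/
def IsTopFinType (A : Type) [CommRing A] [Algebra (Ro K) A] : Prop :=
  ∃ (m : ℕ) (φ : TateAlgR K m →ₐ[Ro K] A), Function.Surjective φ

end RigidQE
end

/-- If all powers of `b` divide those of `a` up to a fixed factor, then so they do for the
remainder of a division by `b`. -/
theorem pow_dvd_mul_sub_pow {A : Type*} [CommRing A] {a b h : A}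
    (H : ∀ n, b ^ n ∣ h * a ^ n) (q : A) (n : ℕ) : b ^ n ∣ h * (a - b * q) ^ n := by
  rw [sub_eq_add_neg, add_pow, Finset.mul_sum]
  refine Finset.dvd_sum fun i hi => ?_
  rw [← mul_assoc, ← mul_assoc]
  refine Dvd.dvd.mul_right ?_ _
  have h1 : b ^ (n - i) ∣ (-(b * q)) ^ (n - i) := by
    rw [neg_pow, mul_pow]
    exact Dvd.dvd.mul_left (dvd_mul_right _ _) _
  rw [← Nat.add_sub_of_le (Nat.lt_succ_iff.1 (Finset.mem_range.1 hi)), pow_add]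
  simp only [add_tsub_cancel_left]
  exact mul_dvd_mul (H i) h1

theorem RingHom.Finite.exists_fin {S S' : Type*} [CommRing S] [CommRing S'] {g : S →+* S'}
    (hg : g.Finite) : ∃ (k : ℕ) (e : Fin k → S'), ∀ x, ∃ c : Fin k → S, ∑ l, g (c l) * e l = x := by
  let _ : Algebra S S' := g.toAlgebra
  have : Module.Finite S S' := hg
  obtain ⟨k, e, he⟩ := Module.Finite.exists_fin (R := S) (M := S')
  exact ⟨k, e, fun x => (Submodule.mem_span_range_iff_exists_fun S).1 (he ▸ Submodule.mem_top)⟩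

section

open IsLocalRing

/-- In a unique factorization domain, `b ^ n ∣ h * a ^ n` for all `n` forces `b ∣ a`. -/
theorem dvd_of_forall_pow_dvd_mul_pow {U : Type*} [CommRing U] [IsDomain U]
    [UniqueFactorizationMonoid U] {a b h : U} (hh : h ≠ 0)
    (H : ∀ n : ℕ, b ^ n ∣ h * a ^ n) : b ∣ a := by
  classical
  let _ := UniqueFactorizationMonoid.toGCDMonoid U
  by_cases ha : a = 0
  · simp [ha]
  obtain ⟨g, a', b', hrel, rfl, rfl⟩ : ∃ g a' b', IsRelPrime a' b' ∧ a = g * a' ∧ b = g * b' := by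
    obtain ⟨a', b', g, hrel, h1, h2⟩ :=
      UniqueFactorizationMonoid.exists_reduced_factors a ha b
    exact ⟨g, a', b', hrel, h1.symm, h2.symm⟩
  have hg : g ≠ 0 := left_ne_zero_of_mul ha
  suffices IsUnit b' from (mul_dvd_mul_iff_left hg).2 this.dvd
  by_contra hb
  obtain ⟨n, hn⟩ := FiniteMultiplicity.of_not_isUnit hb hh
  apply hn
  have h1 := H (n + 1)
  rw [mul_pow, mul_pow, mul_left_comm, mul_dvd_mul_iff_left (pow_ne_zero _ hg)] at h1
  exact (hrel.symm.pow (m := n + 1) (n := n + 1)).dvd_of_dvd_mul_right h1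

/-- Total divisibility gives a coefficient of smallest valuation. -/
theorem exists_mem_forall_dvd {R ι : Type*} [CommRing R] [IsDomain R] [ValuationRing R]
    {s : Finset ι} (hs : s.Nonempty) (f : ι → R) : ∃ i ∈ s, ∀ j ∈ s, f i ∣ f j := by
  induction hs using Finset.Nonempty.cons_induction with
  | singleton a => exact ⟨a, by simp⟩
  | cons a s ha hs ih =>
    obtain ⟨i, hi, h⟩ := ih
    rcases ValuationRing.dvd_total (f a) (f i) with h' | h'
    · exact ⟨a, by simp, by simpa using fun j hj => h'.trans (h j hj)⟩
    · exact ⟨i, by simp [hi], by simpa using ⟨h', h⟩⟩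

theorem MvPolynomial.exists_eq_C_mul_map_residue_ne_zero {R σ : Type*} [CommRing R] [IsDomain R]
    [ValuationRing R] {p : MvPolynomial σ R} (hp : p ≠ 0) :
    ∃ (ρ : R) (q : MvPolynomial σ R), p = C ρ * q ∧ map (residue R) q ≠ 0 := by
  obtain ⟨i, hi, h⟩ := exists_mem_forall_dvd (support_nonempty.2 hp) p.coeff
  obtain ⟨q, hq⟩ := (C_dvd_iff_dvd_coeff (p.coeff i) p).2 fun j => by
    by_cases hj : j ∈ p.support
    · exact h j hj
    · simp [notMem_support_iff.1 hj]
  refine ⟨_, q, hq, fun h0 => ?_⟩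
  have h1 : residue R (q.coeff i) = 0 := by rw [← coeff_map, h0, coeff_zero]
  have h2 : q.coeff i = 1 := by
    have := congrArg (coeff i) hq
    rw [coeff_C_mul] at this
    exact (mul_eq_left₀ (mem_support_iff.1 hi)).1 this.symm
  simp [h2] at h1

/-- The features of the ring `R⟨S₁,…,S_d⟩` of strictly convergent power series over a valuation
ring `R` that determine it: its polynomials, its reduction and its completeness. -/
structure TateModel (R : Type*) [CommRing R] [IsDomain R] [ValuationRing R] (d : ℕ)
    (A : Type*) [CommRing A] [Algebra R A] where
  /-- The inclusion of polynomials. -/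
  poly : MvPolynomial (Fin d) R →ₐ[R] A
  /-- The reduction to polynomials over the residue field. -/
  red : A →ₐ[R] MvPolynomial (Fin d) (ResidueField R)
  red_poly : ∀ p, red (poly p) = MvPolynomial.map (residue R) p
  smul_eq_zero : ∀ (r : R) (a : A), r • a = 0 → r ≠ 0 → a = 0
  exists_eq_smul : ∀ a : A, a ≠ 0 → ∃ (r : R) (a' : A), a = r • a' ∧ red a' ≠ 0
  exists_poly_add : ∀ (r : R) (a : A), r ≠ 0 → ∃ (p : _) (a' : A), a = poly p + r • a'
  exists_series : ∀ (r : R) (a : ℕ → A), ¬ IsUnit r →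
    ∃ s : ℕ → A, ∀ n, s n = a n + r • s (n + 1)
  separated : ∀ (r : R) (a : ℕ → A), ¬ IsUnit r → (∀ n, a n = r • a (n + 1)) → a 0 = 0

namespace TateModel

open MvPolynomial

variable {R : Type*} [CommRing R] [IsDomain R] [ValuationRing R] {d : ℕ}
  {A : Type*} [CommRing A] [Algebra R A] (M : TateModel R d A)

include M

theorem nontrivial : Nontrivial A := M.red.toRingHom.domain_nontrivial

theorem smul_left_cancel {r : R} {a b : A} (hr : r ≠ 0) (h : r • a = r • b) : a = b := by
  rw [← sub_eq_zero]
  exact M.smul_eq_zero r _ (by rw [smul_sub, h, sub_self]) hr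

theorem red_smul_of_not_isUnit {r : R} (hr : ¬ IsUnit r) (a : A) : M.red (r • a) = 0 := by
  rw [map_smul, ← algebraMap_smul (ResidueField R)]
  simp [ResidueField.algebraMap_eq, (residue_eq_zero_iff r).2 hr]

theorem isDomain : IsDomain A := by
  have := M.nontrivial
  refine @NoZeroDivisors.to_isDomain _ _ _ ⟨fun {a b} hab => ?_⟩
  by_contra! h
  obtain ⟨r, a', rfl, ha'⟩ := M.exists_eq_smul a h.1
  obtain ⟨s, b', rfl, hb'⟩ := M.exists_eq_smul b h.2
  have hr : r ≠ 0 := by rintro rfl; simp at h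
  have hs : s ≠ 0 := by rintro rfl; simp at h
  rw [smul_mul_smul_comm] at hab
  have := M.smul_eq_zero _ _ hab (mul_ne_zero hr hs)
  exact mul_ne_zero ha' hb' (by rw [← map_mul, this, map_zero])

theorem exists_eq_smul_of_red_eq_zero (hR : ¬ IsField R) {a : A} (ha : M.red a = 0) :
    ∃ (r : R) (a' : A), r ≠ 0 ∧ ¬ IsUnit r ∧ a = r • a' := by
  by_cases h0 : a = 0
  · obtain ⟨r, hr0, hr⟩ := Ring.exists_not_isUnit_of_not_isField hR
    exact ⟨r, 0, hr0, hr, by simp [h0]⟩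
  · obtain ⟨r, a', rfl, ha'⟩ := M.exists_eq_smul a h0
    refine ⟨r, a', by rintro rfl; simp at h0, fun hr => ha' ?_, rfl⟩
    obtain ⟨u, rfl⟩ := hr
    have : M.red (((u⁻¹ : Rˣ) : R) • (u : R) • a') = 0 := by rw [map_smul, ha, smul_zero]
    simpa [smul_smul] using this

theorem exists_eq_smul_of_smul_eq_mul {b c e : A} {r : R} (hb : M.red b ≠ 0)
    (h : r • e = b * c) : ∃ c', c = r • c' := by
  by_cases hc : c = 0
  · exact ⟨0, by simp [hc]⟩
  obtain ⟨s, c', rfl, hc'⟩ := M.exists_eq_smul c hc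
  have hs : s ≠ 0 := by rintro rfl; simp at hc
  rcases ValuationRing.dvd_total r s with ⟨t, rfl⟩ | ⟨t, rfl⟩
  · exact ⟨t • c', by rw [smul_smul]⟩
  · by_cases ht : IsUnit t
    · obtain ⟨u, rfl⟩ := ht
      exact ⟨((u⁻¹ : Rˣ) : R) • c', by simp [smul_smul, mul_assoc]⟩
    · exfalso
      rw [mul_smul, mul_smul_comm] at h
      have h1 := M.smul_left_cancel hs h
      have h2 := M.red_smul_of_not_isUnit ht e
      rw [h1, map_mul] at h2
      exact mul_ne_zero hb hc' h2

theorem pow_dvd_of_pow_dvd_smul {a b h : A} {r : R} (hr : r ≠ 0) (hb : M.red b ≠ 0)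
    (H : ∀ n, b ^ n ∣ h * (r • a) ^ n) (n : ℕ) : b ^ n ∣ h * a ^ n := by
  obtain ⟨c, hc⟩ := H n
  rw [smul_pow, mul_smul_comm] at hc
  obtain ⟨c', rfl⟩ := M.exists_eq_smul_of_smul_eq_mul (by rw [map_pow]; exact pow_ne_zero _ hb) hc
  rw [mul_smul_comm] at hc
  exact ⟨c', M.smul_left_cancel (pow_ne_zero _ hr) hc⟩

theorem red_dvd_red {a b h : A} (hh : M.red h ≠ 0) (H : ∀ n, b ^ n ∣ h * a ^ n) :
    M.red b ∣ M.red a :=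
  dvd_of_forall_pow_dvd_mul_pow hh fun n => by
    simpa only [map_pow, map_mul] using map_dvd M.red (H n)

/-- An element with nonzero reduction is, up to a multiple of a non-unit, a polynomial with
invertible leading coefficient. -/
theorem exists_poly_isUnit_leadingCoeff (hR : ¬ IsField R) (m : MonomialOrder (Fin d)) {b : A}
    (hb : M.red b ≠ 0) : ∃ (p : MvPolynomial (Fin d) R) (r : R) (b' : A), r ≠ 0 ∧ ¬ IsUnit r ∧
      b = M.poly p + r • b' ∧ IsUnit (m.leadingCoeff p) ∧ m.degree p = m.degree (M.red b) := by
  classical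
  choose g hg using residue_surjective (R := R)
  let p : MvPolynomial (Fin d) R := ∑ i ∈ (M.red b).support, monomial i (g ((M.red b).coeff i))
  have hp : ∀ j, p.coeff j = if j ∈ (M.red b).support then g ((M.red b).coeff j) else 0 := by
    intro j
    simp only [p, coeff_sum, coeff_monomial]
    rw [Finset.sum_ite_eq']
  have hmap : map (residue R) p = M.red b := by
    ext j
    rw [coeff_map, hp]
    split_ifs with h
    · exact hg _
    · rw [map_zero, notMem_support_iff.1 h]
  obtain ⟨r, b', hr0, hr, h⟩ := M.exists_eq_smul_of_red_eq_zero hR (a := b - M.poly p)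
    (by rw [map_sub, M.red_poly, hmap, sub_self])
  have hunit : IsUnit (p.coeff (m.degree (M.red b))) := by
    rw [← residue_ne_zero_iff_isUnit, ← coeff_map, hmap]
    exact m.leadingCoeff_ne_zero_iff.2 hb
  have hdeg : m.degree p = m.degree (M.red b) := by
    apply m.toSyn.injective
    apply le_antisymm
    · refine m.degree_le_iff.2 fun c hc => m.le_degree ?_
      by_contra h
      rw [mem_support_iff, hp, if_neg h] at hc
      exact hc rfl
    · exact m.le_degree (mem_support_iff.2 hunit.ne_zero)
  exact ⟨p, r, b', hr0, hr, by rw [← h]; ring, by rwa [MonomialOrder.leadingCoeff, hdeg], hdeg⟩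

theorem exists_eq_mul_add_smul (hR : ¬ IsField R) {b h : A} (hb : M.red b ≠ 0)
    (hh : M.red h ≠ 0) : ∃ r : R, r ≠ 0 ∧ ¬ IsUnit r ∧
      ∀ a, (∀ n, b ^ n ∣ h * a ^ n) → ∃ q a', a = b * q + r • a' := by
  let m : MonomialOrder (Fin d) := MonomialOrder.lex
  obtain ⟨p, r, b', hr0, hr, hbp, hlead, hdeg⟩ := M.exists_poly_isUnit_leadingCoeff hR m hb
  refine ⟨r, hr0, hr, fun a H => ?_⟩
  obtain ⟨f, a', ha⟩ := M.exists_poly_add r a hr0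
  obtain ⟨q, t, hqt, -, ht⟩ := m.div_single hlead f
  have key : a - b * M.poly q = M.poly t + r • (a' - b' * M.poly q) := by
    rw [ha, hqt, map_add, map_mul, smul_sub, ← smul_mul_assoc, eq_sub_of_add_eq' hbp.symm]
    ring
  generalize a' - b' * M.poly q = e at key
  suffices ∃ e', M.poly t = r • e' by
    obtain ⟨e', he'⟩ := this
    exact ⟨M.poly q, e' + e, by rw [smul_add, ← he', ← key]; ring⟩
  by_cases ht0 : t = 0
  · exact ⟨0, by simp [ht0]⟩
  obtain ⟨s, t', rfl, ht'⟩ := exists_eq_C_mul_map_residue_ne_zero ht0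
  have hs : s ≠ 0 := by rintro rfl; simp at ht0
  have hpoly : M.poly (C s * t') = s • M.poly t' := by
    rw [map_mul, ← algebraMap_eq, AlgHom.commutes, Algebra.smul_def]
  rw [hpoly] at key ⊢
  rcases ValuationRing.dvd_total r s with ⟨u, rfl⟩ | ⟨u, rfl⟩
  · exact ⟨u • M.poly t', by rw [smul_smul]⟩
  by_cases hu : IsUnit u
  · obtain ⟨u, rfl⟩ := hu
    exact ⟨((u⁻¹ : Rˣ) : R) • M.poly t', by simp [smul_smul, mul_assoc]⟩
  exfalso
  rw [mul_smul, ← smul_add] at key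
  have H1 := pow_dvd_mul_sub_pow H (M.poly q)
  rw [key] at H1
  obtain ⟨c, hc⟩ := M.red_dvd_red hh (M.pow_dvd_of_pow_dvd_smul hs hb H1)
  rw [map_add, M.red_smul_of_not_isUnit hu, add_zero, M.red_poly] at hc
  have hd := m.degree_mul' (hc ▸ ht')
  rw [← hc] at hd
  have hmem := m.degree_mem_support ht'
  rw [mem_support_iff, coeff_map] at hmem
  refine ht (m.degree (map (residue R) t')) ?_ ?_
  · rw [mem_support_iff, coeff_C_mul]
    exact mul_ne_zero hs fun h => hmem (by rw [h, map_zero])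
  · rw [hdeg, hd]
    exact le_self_add

theorem dvd_of_forall_pow_dvd_mul_pow (hR : ¬ IsField R) {a b h : A} (hb : M.red b ≠ 0)
    (hh : M.red h ≠ 0) (H : ∀ n, b ^ n ∣ h * a ^ n) : b ∣ a := by
  obtain ⟨r, hr0, hr, hdiv⟩ := M.exists_eq_mul_add_smul hR hb hh
  let S := {a : A // ∀ n, b ^ n ∣ h * a ^ n}
  have : ∀ x : S, ∃ (q : A) (y : S), (x : A) = b * q + r • (y : A) := by
    rintro ⟨x, hx⟩
    obtain ⟨q, y, hy⟩ := hdiv x hx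
    refine ⟨q, ⟨y, M.pow_dvd_of_pow_dvd_smul hr0 hb ?_⟩, hy⟩
    rw [show r • y = x - b * q by rw [hy]; ring]
    exact pow_dvd_mul_sub_pow hx q
  choose q next hnext using this
  let x : ℕ → S := fun n => next^[n] ⟨a, H⟩
  obtain ⟨s, hs⟩ := M.exists_series r (fun n => q (x n)) hr
  have h0 := M.separated r (fun n => (x n : A) - b * s n) hr fun n => by
    have : x (n + 1) = next (x n) := Function.iterate_succ_apply' _ _ _
    simp only [this, hs n]
    rw [hnext (x n), smul_sub, ← mul_smul_comm]
    ring
  exact ⟨s 0, sub_eq_zero.1 h0⟩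

theorem dvd_of_forall_pow_dvd_mul_pow' (hR : ¬ IsField R) {a b h : A} (hb : b ≠ 0)
    (hh : h ≠ 0) (H : ∀ n, b ^ n ∣ h * a ^ n) : b ∣ a := by
  have := M.isDomain
  obtain ⟨s, b, rfl, hb'⟩ := M.exists_eq_smul b hb
  obtain ⟨t, h, rfl, hh'⟩ := M.exists_eq_smul h hh
  have hs : s ≠ 0 := by rintro rfl; simp at hb
  have ht : t ≠ 0 := by rintro rfl; simp at hh
  have hbn : ∀ n, M.red (b ^ n) ≠ 0 := fun n => by rw [map_pow]; exact pow_ne_zero n hb'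
  obtain ⟨c, rfl⟩ := M.dvd_of_forall_pow_dvd_mul_pow (a := a) hR hb' hh' fun n => by
    obtain ⟨e, he⟩ := H n
    have he' : t • (h * a ^ n) = b ^ n * s ^ n • e := by
      simp only [Algebra.smul_def, mul_pow, map_pow] at he ⊢
      linear_combination he
    obtain ⟨c', hc'⟩ := M.exists_eq_smul_of_smul_eq_mul (hbn n) he'
    rw [hc', mul_smul_comm] at he'
    exact ⟨c', M.smul_left_cancel ht he'⟩
  by_cases hc : c = 0
  · simp [hc]
  obtain ⟨u, c, rfl, hc'⟩ := M.exists_eq_smul c hc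
  have hu : u ≠ 0 := by rintro rfl; simp at hc
  have hdvd : s ∣ u → s • b ∣ b * u • c := by
    rintro ⟨w, rfl⟩
    exact ⟨w • c, by simp only [Algebra.smul_def, map_mul]; ring⟩
  rcases ValuationRing.dvd_total s u with h1 | ⟨v, rfl⟩
  · exact hdvd h1
  by_cases hv : IsUnit v
  · exact hdvd (hv.mul_right_dvd.2 dvd_rfl)
  exfalso
  have hpow : ∀ n, ∃ w, t = v ^ n * w := fun n => by
    obtain ⟨e, he⟩ := H n
    have he' : v ^ n • e = t • (h * c ^ n) := by
      apply M.smul_left_cancel (pow_ne_zero n hu)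
      apply mul_left_cancel₀ (pow_ne_zero n (fun h0 : b = 0 => hb' (by rw [h0, map_zero])))
      simp only [Algebra.smul_def, map_mul, mul_pow, map_pow] at he ⊢
      linear_combination -he
    rcases ValuationRing.dvd_total (v ^ n) t with h1 | ⟨w, hw⟩
    · exact h1
    · by_cases hw' : IsUnit w
      · rw [hw]
        exact (hw'.mul_right_dvd.2 dvd_rfl)
      · rw [hw, mul_smul] at he'
        have h2 := M.red_smul_of_not_isUnit hw' e
        rw [M.smul_left_cancel ht he', map_mul, map_pow] at h2
        exact absurd h2 (mul_ne_zero hh' (pow_ne_zero _ hc'))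
  choose w hw using hpow
  have hv0 : v ≠ 0 := right_ne_zero_of_mul hs
  have := M.separated v (fun n => w n • 1) hv fun n => by
    rw [smul_smul]
    congr 1
    apply mul_left_cancel₀ (pow_ne_zero n hv0)
    rw [← hw n, ← mul_assoc, ← pow_succ, ← hw]
  have h1 := hw 0
  rw [pow_zero, one_mul] at h1
  simp only [← h1] at this
  exact one_ne_zero (M.smul_eq_zero _ _ this ht)

theorem isIntegrallyClosed (hR : ¬ IsField R) : IsIntegrallyClosed A := by
  have := M.isDomain
  refine (isIntegrallyClosed_iff (FractionRing A)).2 fun {x} hx => ?_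
  obtain ⟨h, hh, hx⟩ := hx.isAlmostIntegral
  obtain ⟨a, b, hb, rfl⟩ := IsFractionRing.div_surjective (A := A) x
  have hb0 := nonZeroDivisors.ne_zero hb
  obtain ⟨c, rfl⟩ := M.dvd_of_forall_pow_dvd_mul_pow' hR (a := a) hb0
    (nonZeroDivisors.ne_zero hh) fun n => by
      obtain ⟨y, hy⟩ := hx n
      refine ⟨y, ?_⟩
      apply IsFractionRing.injective A (FractionRing A)
      have : algebraMap A (FractionRing A) b ≠ 0 := by simpa using hb0
      rw [Algebra.smul_def] at hy
      rw [map_mul, map_mul, hy, map_pow, map_pow, div_pow]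
      field_simp
  refine ⟨c, ?_⟩
  have : algebraMap A (FractionRing A) b ≠ 0 := by simpa using hb0
  rw [map_mul]
  field_simp

theorem red_surjective : Function.Surjective M.red := fun f => by
  obtain ⟨p, rfl⟩ := map_surjective (σ := Fin d) (residue R) residue_surjective f
  exact ⟨M.poly p, M.red_poly p⟩

/-- A point of `A` over the residue field only depends on the reduction. -/
theorem algHom_residueField_eq_zero (hR : ¬ IsField R) (f : A →ₐ[R] ResidueField R) {a : A}
    (ha : M.red a = 0) : f a = 0 := by
  obtain ⟨r, a', -, hr, rfl⟩ := M.exists_eq_smul_of_red_eq_zero hR ha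
  rw [map_smul, Algebra.smul_def, ResidueField.algebraMap_eq, (residue_eq_zero_iff r).2 hr,
    zero_mul]

theorem algHom_residueField_ext (hR : ¬ IsField R) {f g : A →ₐ[R] ResidueField R}
    (h : ∀ i, f (M.poly (X i)) = g (M.poly (X i))) : f = g := by
  obtain ⟨r, hr0, hr⟩ := Ring.exists_not_isUnit_of_not_isField hR
  have hpoly : f.comp M.poly = g.comp M.poly := MvPolynomial.algHom_ext h
  ext a
  obtain ⟨p, a', rfl⟩ := M.exists_poly_add r a hr0
  have h1 : ∀ f : A →ₐ[R] ResidueField R, f (r • a') = 0 := fun f =>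
    M.algHom_residueField_eq_zero hR f (M.red_smul_of_not_isUnit hr a')
  rw [map_add, map_add, h1, h1, add_zero, add_zero]
  exact DFunLike.congr_fun hpoly p

section Normalization

variable {D : Type*} [CommRing D] [Algebra R D] {T : Type*} [CommRing T] [Algebra R T]

/-- Successive approximation: if every element of `A` is congruent modulo a non-unit to a
combination of the `e l` with coefficients in `T` and of the `ν i` with coefficients in `A`, then
every element is such a combination. -/
theorem exists_eq_sum_of_approx {n : ℕ} (N : TateModel R n T) (θ : T →ₐ[R] A) {κ ι : Type*}
    [Fintype κ] [Fintype ι] (e : κ → A) (ν : ι → A) {r : R} (hr : ¬ IsUnit r)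
    (H : ∀ a, ∃ (c : κ → T) (b : ι → A) (a' : A),
      a = ∑ l, θ (c l) * e l + ∑ i, b i * ν i + r • a') (a : A) :
    ∃ (c : κ → T) (b : ι → A), a = ∑ l, θ (c l) * e l + ∑ i, b i * ν i := by
  choose c b next H using H
  let x : ℕ → A := fun n => next^[n] a
  choose s hs using fun l => N.exists_series r (fun n => c (x n) l) hr
  choose t ht using fun i => M.exists_series r (fun n => b (x n) i) hr
  have h0 := M.separated r
    (fun n => x n - (∑ l, θ (s l n) * e l + ∑ i, t i n * ν i)) hr fun n => by
      have hx : x (n + 1) = next (x n) := Function.iterate_succ_apply' _ _ _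
      simp only [hx, hs _ n, ht _ n]
      nth_rewrite 1 [H (x n)]
      simp only [map_add, map_smul, add_mul, Finset.sum_add_distrib, smul_sub, smul_add,
        Finset.smul_sum, smul_mul_assoc]
      ring
  exact ⟨fun l => s l 0, fun i => t i 0, sub_eq_zero.1 h0⟩

/-- A finite set of module generators modulo `ker ψ` and modulo non-units generates the whole
ring modulo finitely many elements of `ker ψ` and a single non-unit. -/
theorem exists_uniform_approx (θ : T →ₐ[R] A) (ψ : A →ₐ[R] D) {κ : Type} [Finite κ]
    (e : κ → A) (H : ∀ a, ∃ (c : κ → T) (ν : A) (r : R) (a' : A), ψ ν = 0 ∧ r ≠ 0 ∧ ¬ IsUnit r ∧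
      a = ∑ᶠ l, θ (c l) * e l + ν + r • a') :
    ∃ (ι : Type) (_ : Fintype ι) (ν : ι → A) (r : R), (∀ i, ψ (ν i) = 0) ∧ ¬ IsUnit r ∧
      ∀ a, ∃ (c : κ → T) (b : ι → A) (a' : A),
        a = ∑ᶠ l, θ (c l) * e l + ∑ i, b i * ν i + r • a' := by
  have := Fintype.ofFinite κ
  simp only [finsum_eq_sum_of_fintype] at H ⊢
  let z : Option (Fin d × κ) → A := fun o => o.elim 1 fun p => M.poly (X p.1) * e p.2
  choose c ν r a' hν hr0 hr hz using fun o => H (z o)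
  obtain ⟨o, -, ho⟩ := exists_mem_forall_dvd (Finset.univ_nonempty (α := Option (Fin d × κ))) r
  refine ⟨Option (Fin d × κ), inferInstance, ν, r o, hν, hr o, ?_⟩
  let _ : Algebra T A := θ.toRingHom.toAlgebra
  have hsmul : ∀ (t : T) (a : A), t • a = θ t * a := fun _ _ => rfl
  let I : Ideal A := Ideal.span (Set.range ν) ⊔ Ideal.span {algebraMap R A (r o)}
  let P : Submodule T A := Submodule.span T (Set.range e) ⊔ I.restrictScalars T
  have hIP : ∀ x ∈ I, x ∈ P := fun x hx => Submodule.mem_sup_right (by simpa using hx)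
  have hrI : ∀ (s : R) (x : A), r o ∣ s → s • x ∈ I := by
    rintro _ x ⟨s, rfl⟩
    refine Submodule.mem_sup_right (Ideal.mem_span_singleton.2 ⟨s • x, ?_⟩)
    simp only [Algebra.smul_def, map_mul]
    ring
  have hzP : ∀ i, z i ∈ P := fun i => by
    rw [hz i]
    refine add_mem (add_mem (sum_mem fun l _ => ?_) ?_) (hIP _ (hrI _ _ (ho i (Finset.mem_univ _))))
    · rw [← hsmul]
      exact P.smul_mem _ (Submodule.mem_sup_left (Submodule.subset_span ⟨l, rfl⟩))
    · exact hIP _ (Submodule.mem_sup_left (Ideal.subset_span ⟨i, rfl⟩))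
  have hXP : ∀ i, ∀ x ∈ P, M.poly (X i) * x ∈ P := fun i x hx => by
    obtain ⟨u, hu, y, hy, rfl⟩ := Submodule.mem_sup.1 hx
    rw [mul_add]
    refine add_mem ?_ (hIP _ (I.mul_mem_left _ (by simpa using hy)))
    clear hx
    induction hu using Submodule.span_induction with
    | mem u hu => obtain ⟨l, rfl⟩ := hu; exact hzP (some (i, l))
    | zero => simp
    | add u v _ _ hu hv => rw [mul_add]; exact add_mem hu hv
    | smul t u _ hu =>
      rw [hsmul, mul_left_comm, ← hsmul]
      exact P.smul_mem _ hu
  have hpoly : ∀ p, M.poly p ∈ P := fun p => by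
    induction p using MvPolynomial.induction_on with
    | C s =>
      have : M.poly (C s) = algebraMap R T s • z none := by
        rw [hsmul, AlgHom.commutes, ← algebraMap_eq, AlgHom.commutes]
        exact (mul_one _).symm
      rw [this]
      exact P.smul_mem _ (hzP none)
    | add p q hp hq => rw [map_add]; exact add_mem hp hq
    | mul_X p i hp => rw [map_mul, mul_comm]; exact hXP i _ hp
  intro a
  obtain ⟨p, a', ha⟩ := M.exists_poly_add (r o) a (hr0 o)
  obtain ⟨x, hx, y, hy, hxy⟩ := Submodule.mem_sup.1 (hpoly p)
  obtain ⟨c, rfl⟩ := (Submodule.mem_span_range_iff_exists_fun T).1 hx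
  obtain ⟨v, hv, w, hw, rfl⟩ := Submodule.mem_sup.1 (show y ∈ I by simpa using hy)
  obtain ⟨b, rfl⟩ := Ideal.mem_span_range_iff_exists_fun.1 hv
  obtain ⟨w, rfl⟩ := Ideal.mem_span_singleton.1 hw
  refine ⟨c, b, w + a', ?_⟩
  rw [ha, ← hxy, smul_add, Algebra.smul_def _ w]
  simp only [hsmul]
  ring

/-- Noether normalization for quotients of a ring of strictly convergent power series. -/
theorem exists_finite_injective (hR : ¬ IsField R) (T : ℕ → Type*) [∀ n, CommRing (T n)]
    [∀ n, Algebra R (T n)] (N : ∀ n, TateModel R n (T n))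
    (hsubst : ∀ (n : ℕ) (t : Fin n → A), ∃ θ : T n →ₐ[R] A,
      ∀ f, M.red (θ f) = aeval (fun i => M.red (t i)) ((N n).red f))
    (ψ : A →ₐ[R] D) (hψ : Function.Surjective ψ)
    (hD : ∀ (r : R) (x : D), r • x = 0 → r ≠ 0 → x = 0) (y : D →ₐ[R] ResidueField R) :
    ∃ (n : ℕ) (χ : T n →ₐ[R] D), Function.Injective χ ∧ χ.Finite := by
  let J : Ideal (MvPolynomial (Fin d) (ResidueField R)) := (RingHom.ker ψ).map M.red
  have hJ : ∀ a, M.red a ∈ J → ∃ (ν : A) (r : R) (a' : A), ψ ν = 0 ∧ r ≠ 0 ∧ ¬ IsUnit r ∧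
      a = ν + r • a' := fun a ha => by
    obtain ⟨ν, hν, h⟩ := (Ideal.mem_map_iff_of_surjective M.red M.red_surjective).1 ha
    obtain ⟨r, a', hr0, hr, h⟩ := M.exists_eq_smul_of_red_eq_zero hR (a := a - ν)
      (by rw [map_sub, h, sub_self])
    exact ⟨ν, r, a', hν, hr0, hr, by rw [← h]; ring⟩
  have : Nontrivial (MvPolynomial (Fin d) (ResidueField R) ⧸ J) := by
    refine Ideal.Quotient.nontrivial_iff.2 fun h => ?_
    obtain ⟨ν, r, a', hν, -, hr, h1⟩ := hJ 1 (h ▸ Submodule.mem_top)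
    have h2 := congrArg (fun a => y (ψ a)) h1
    simp only [map_one, map_add, hν, zero_add] at h2
    have h3 := M.algHom_residueField_eq_zero hR (y.comp ψ) (M.red_smul_of_not_isUnit hr a')
    exact one_ne_zero (h2.trans h3)
  obtain ⟨n, g, hginj, hgfin⟩ := exists_finite_inj_algHom_of_fg (ResidueField R)
    (MvPolynomial (Fin d) (ResidueField R) ⧸ J)
  have hq : Function.Surjective fun a => Ideal.Quotient.mk J (M.red a) :=
    Ideal.Quotient.mk_surjective.comp M.red_surjective
  choose t ht using fun i => hq (g (X i))
  obtain ⟨θ, hθ⟩ := hsubst n t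
  have hθg : ∀ f, Ideal.Quotient.mk J (M.red (θ f)) = g ((N n).red f) := fun f => by
    have : (Ideal.Quotient.mkₐ (ResidueField R) J).comp (aeval fun i => M.red (t i)) = g :=
      MvPolynomial.algHom_ext fun i => by simpa using ht i
    rw [hθ, ← this]
    rfl
  refine ⟨n, ψ.comp θ, (injective_iff_map_eq_zero _).2 fun f hf => ?_, ?_⟩
  · by_contra hf0
    obtain ⟨r, f, rfl, hf'⟩ := (N n).exists_eq_smul f hf0
    have hr : r ≠ 0 := by rintro rfl; simp at hf0
    rw [map_smul] at hf
    have h1 : θ f ∈ RingHom.ker ψ := hD r _ hf hr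
    have h2 := hθg f
    rw [Ideal.Quotient.eq_zero_iff_mem.2 (Ideal.mem_map_of_mem M.red h1)] at h2
    exact hf' (hginj (by rw [← h2, map_zero]))
  · obtain ⟨k, e, he⟩ := RingHom.Finite.exists_fin hgfin
    choose e' he' using fun l => hq (e l)
    obtain ⟨ι, _, ν, r, hν, hr, H⟩ := M.exists_uniform_approx θ ψ e' fun a => by
      obtain ⟨c, hc⟩ := he (Ideal.Quotient.mk J (M.red a))
      choose c' hc' using fun l => (N n).red_surjective (c l)
      obtain ⟨ν, r, a', hν, hr0, hr, h⟩ := hJ (a - ∑ l, θ (c' l) * e' l) <| by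
        rw [← Ideal.Quotient.eq_zero_iff_mem, map_sub, map_sub, sub_eq_zero, ← hc, map_sum,
          map_sum]
        refine Finset.sum_congr rfl fun l _ => ?_
        rw [map_mul, map_mul, hθg, hc', ← he' l]
        rfl
      refine ⟨c', ν, r, a', hν, hr0, hr, ?_⟩
      rw [finsum_eq_sum_of_fintype, add_assoc, ← h]
      ring
    simp only [finsum_eq_sum_of_fintype] at H
    let _ : Algebra (T n) D := (ψ.comp θ).toRingHom.toAlgebra
    refine ⟨Submodule.fg_def.2 ⟨_, Set.finite_range fun l => ψ (e' l), eq_top_iff.2 ?_⟩⟩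
    rintro x -
    obtain ⟨a, rfl⟩ := hψ x
    obtain ⟨c, b, rfl⟩ := M.exists_eq_sum_of_approx (N n) θ e' ν hr H a
    refine (Submodule.mem_span_range_iff_exists_fun _).2 ⟨c, ?_⟩
    simp only [map_add, map_sum, map_mul, hν, mul_zero, Finset.sum_const_zero, add_zero]
    rfl

end Normalization

/-- Lifting of residue points along a finite injective extension of a ring of strictly convergent
power series. -/
theorem exists_lift_of_finite (hR : ¬ IsField R)
    (hsplit : ∀ p : Polynomial R, p.Monic → p.Splits)
    (hev : ∀ b : Fin d → R, ∃ ev : A →ₐ[R] R, ∀ i, ev (M.poly (X i)) = b i)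
    {D : Type*} [CommRing D] [IsDomain D] [Algebra R D] (χ : A →ₐ[R] D)
    (hχ : Function.Injective χ) (hfin : χ.Finite) (y : D →ₐ[R] ResidueField R) :
    ∃ z : D →ₐ[R] R, ∀ x, residue R (z x) = y x := by
  have := M.isDomain
  have := M.isIntegrallyClosed hR
  choose b hb using fun i => residue_surjective (y (χ (M.poly (X i))))
  obtain ⟨ev, hev⟩ := hev b
  have hred : ∀ f, residue R (ev f) = y (χ f) := fun f => by
    have : (IsScalarTower.toAlgHom R R (ResidueField R)).comp ev = y.comp χ :=
      M.algHom_residueField_ext hR fun i => by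
        simp only [AlgHom.comp_apply, hev, ← hb]
        rfl
    exact DFunLike.congr_fun this f
  have := RingHom.ker_isPrime ev
  have := RingHom.ker_isPrime y
  let _ : Algebra A D := χ.toRingHom.toAlgebra
  have : IsScalarTower R A D := .of_algebraMap_eq fun r => (χ.commutes r).symm
  have : FaithfulSMul A D := (faithfulSMul_iff_algebraMap_injective A D).2 hχ
  have : Algebra.IsIntegral A D := ⟨hfin.to_isIntegral⟩
  have : (RingHom.ker y).LiesOver ((RingHom.ker y).under A) := inferInstance
  obtain ⟨P, hPQ, hP, hPover⟩ := Ideal.exists_ideal_le_liesOver_of_le (p := RingHom.ker ev)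
    (q := (RingHom.ker y).under A) (RingHom.ker y) fun f hf => by
      change y (χ f) = 0
      rw [← hred, show ev f = 0 from hf, map_zero]
  have hPmem : ∀ f, χ f ∈ P ↔ ev f = 0 := fun f => by
    change f ∈ P.under A ↔ _
    rw [← hPover.over]
    rfl
  have hmk : ∀ f, Ideal.Quotient.mk P (χ f) = Ideal.Quotient.mk P (algebraMap R D (ev f)) := by
    intro f
    rw [Ideal.Quotient.eq, ← χ.commutes, ← map_sub, hPmem]
    simp
  have hbij : Function.Bijective (algebraMap R (D ⧸ P)) := by
    refine ⟨(injective_iff_map_eq_zero _).2 fun r hr => ?_, fun x => ?_⟩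
    · have h1 := Ideal.Quotient.eq_zero_iff_mem.1 (show Ideal.Quotient.mk P (algebraMap R D r) = 0
        from hr)
      rw [← χ.commutes, hPmem] at h1
      simpa using h1
    · obtain ⟨x, rfl⟩ := Ideal.Quotient.mk_surjective x
      obtain ⟨F, hF, hx⟩ := hfin.to_isIntegral x
      have h1 : (F.map ev.toRingHom).eval₂ (algebraMap R (D ⧸ P)) (Ideal.Quotient.mk P x) = 0 := by
        rw [Polynomial.eval₂_map]
        have : (algebraMap R (D ⧸ P)).comp ev.toRingHom =
            (Ideal.Quotient.mk P).comp χ.toRingHom := RingHom.ext fun f => (hmk f).symm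
        rw [this, ← Polynomial.hom_eval₂]
        exact (congrArg _ hx).trans (map_zero _)
      have hsp := hsplit _ (hF.map ev.toRingHom)
      rw [hsp.eq_prod_roots_of_monic (hF.map ev.toRingHom), Polynomial.eval₂_multiset_prod,
        Multiset.prod_eq_zero_iff, Multiset.map_map] at h1
      obtain ⟨r, -, hr⟩ := Multiset.mem_map.1 h1
      refine ⟨r, ?_⟩
      exact (sub_eq_zero.1 (by simpa using hr)).symm
  let E : R ≃ₐ[R] D ⧸ P := AlgEquiv.ofBijective (Algebra.ofId R (D ⧸ P)) hbij
  refine ⟨E.symm.toAlgHom.comp (Ideal.Quotient.mkₐ R P), fun x => ?_⟩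
  have h1 : algebraMap R (D ⧸ P) (E.symm (Ideal.Quotient.mk P x)) = Ideal.Quotient.mk P x :=
    E.apply_symm_apply _
  have h2 := hPQ (Ideal.Quotient.eq.1 (show Ideal.Quotient.mk P (algebraMap R D
    (E.symm (Ideal.Quotient.mk P x))) = Ideal.Quotient.mk P x from h1))
  rw [RingHom.mem_ker, map_sub, AlgHom.commutes, sub_eq_zero] at h2
  exact h2

end TateModel

end

noncomputable section

namespace RigidQE

open IsLocalRing MvPolynomial

section ValuationRing

variable {K : Type} [NormedField K] [IsUltrametricDist K]

theorem Ro.dvd_iff {a b : Ro K} : a ∣ b ↔ ‖(b : K)‖ ≤ ‖(a : K)‖ := by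
  refine ⟨?_, fun h => ?_⟩
  · rintro ⟨c, rfl⟩
    simpa using mul_le_mul_of_nonneg_left c.2 (norm_nonneg (a : K))
  · by_cases ha : (a : K) = 0
    · have hb : (b : K) = 0 := by simpa [ha] using h
      exact ⟨0, Subtype.ext (by simpa using hb)⟩
    · refine ⟨⟨b / a, ?_⟩, Subtype.ext (mul_div_cancel₀ _ ha).symm⟩
      change ‖(b : K) / a‖ ≤ 1
      rw [norm_div]
      exact div_le_one_of_le₀ h (norm_nonneg _)

instance : ValuationRing (Ro K) :=
  ValuationRing.iff_dvd_total.2 ⟨fun a b => by simpa only [Ro.dvd_iff] using le_total _ _⟩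

theorem Ro.isUnit_iff {a : Ro K} : IsUnit a ↔ 1 ≤ ‖(a : K)‖ := by
  rw [isUnit_iff_dvd_one, Ro.dvd_iff]
  simp

theorem Ro.residue_eq_zero_iff {a : Ro K} : residue (Ro K) a = 0 ↔ ‖(a : K)‖ < 1 := by
  rw [IsLocalRing.residue_eq_zero_iff, mem_maximalIdeal, mem_nonunits_iff, Ro.isUnit_iff, not_le]

theorem RoMax_eq_maximalIdeal : RoMax K = maximalIdeal (Ro K) := by
  ext a
  rw [← IsLocalRing.residue_eq_zero_iff, Ro.residue_eq_zero_iff]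
  rfl

theorem Ro.norm_le_one_of_isIntegral {x : K} (hx : IsIntegral (Ro K) x) : ‖x‖ ≤ 1 := by
  have : (NormedField.valuation (K := K)).Integers (Ro K) :=
    ⟨Subtype.val_injective, fun a => a.2, fun {x} h => ⟨⟨x, h⟩, rfl⟩⟩
  exact this.mem_of_integral hx

theorem Ro.splits [IsAlgClosed K] {p : Polynomial (Ro K)} (hp : p.Monic) : p.Splits := by
  refine Polynomial.Splits.of_splits_map_of_injective (i := (Ro K).subtype)
    Subtype.val_injective (IsAlgClosed.splits _) fun x hx => ?_
  refine ⟨⟨x, Ro.norm_le_one_of_isIntegral ⟨p, hp, ?_⟩⟩, rfl⟩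
  have := (Polynomial.mem_roots'.1 hx).2
  rwa [Polynomial.IsRoot, Polynomial.eval_map] at this

instance [IsAlgClosed K] : IsAlgClosed (ResidueField (Ro K)) := by
  refine .of_exists_root _ fun p hp hirr => ?_
  obtain ⟨q, rfl, hdeg, hq⟩ := Polynomial.lifts_and_degree_eq_and_monic
    ((Polynomial.lifts_iff_coeff_lifts p).2 fun n => residue_surjective _) hp
  exact (Polynomial.Splits.map (Ro.splits hq) _).exists_eval_eq_zero hirr.degree_pos.ne'

end ValuationRing

section TateAlgebra

variable {K : Type} [NormedField K] {m n : ℕ}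

theorem coordFn_mem_TateAlg (i : Fin m) : coordFn K m i ∈ TateAlg K m :=
  Subalgebra.le_topologicalClosure _ (Algebra.subset_adjoin ⟨i, rfl⟩)

theorem isClosed_TateAlg : IsClosed (TateAlg K m : Set (UnitBall K m →ᵇ K)) :=
  Subalgebra.isClosed_topologicalClosure _

/-- Pullback of bounded functions along a map of polydiscs. -/
def pull (τ : C(UnitBall K m, UnitBall K n)) : (UnitBall K n →ᵇ K) →ₐ[K] (UnitBall K m →ᵇ K) where
  toFun f := f.compContinuous τ
  map_one' := rfl
  map_mul' _ _ := rfl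
  map_zero' := rfl
  map_add' _ _ := rfl
  commutes' _ := rfl

theorem continuous_pull (τ : C(UnitBall K m, UnitBall K n)) : Continuous (pull τ) :=
  BoundedContinuousFunction.continuous_compContinuous τ

variable [IsUltrametricDist K]

/-- The point of the closed unit polydisc with given coordinates. -/
def UnitBall.mk (b : Fin m → Ro K) : UnitBall K m := ⟨fun i => b i, fun i => (b i).2⟩

theorem UnitBall.mk_surjective : Function.Surjective (UnitBall.mk (K := K) (m := m)) :=
  fun x => ⟨fun i => ⟨x.1 i, x.2 i⟩, rfl⟩

namespace TateAlgR

/-- Evaluation at a point of the closed unit polydisc. -/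
def eval (b : Fin m → Ro K) : TateAlgR K m →ₐ[Ro K] Ro K where
  toFun f := ⟨f.1 (UnitBall.mk b), (f.1.norm_coe_le_norm _).trans f.2.2⟩
  map_one' := rfl
  map_mul' _ _ := rfl
  map_zero' := rfl
  map_add' _ _ := rfl
  commutes' r := Subtype.ext <| by
    change algebraMap K (UnitBall K m →ᵇ K) r (UnitBall.mk b) = r
    simp

theorem ext_eval {f g : TateAlgR K m} (h : ∀ b, eval b f = eval b g) : f = g :=
  Subtype.ext <| BoundedContinuousFunction.ext <| UnitBall.mk_surjective.forall.2 fun b =>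
    congrArg Subtype.val (h b)

theorem norm_le_of_forall {f : UnitBall K m →ᵇ K} {C : ℝ} (hC : 0 ≤ C)
    (h : ∀ b, ‖f (UnitBall.mk b)‖ ≤ C) : ‖f‖ ≤ C :=
  (BoundedContinuousFunction.norm_le hC).2 (UnitBall.mk_surjective.forall.2 h)

variable (K) in
/-- The inclusion of polynomials in strictly convergent power series. -/
def poly (m : ℕ) : MvPolynomial (Fin m) (Ro K) →ₐ[Ro K] TateAlgR K m :=
  aeval fun i => ⟨coordFn K m i, coordFn_mem_TateAlg i,
    norm_le_of_forall zero_le_one fun b => (b i).2⟩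

theorem eval_poly (b : Fin m → Ro K) (p : MvPolynomial (Fin m) (Ro K)) :
    eval b (poly K m p) = MvPolynomial.eval b p := by
  have : (eval b).comp (poly K m) = aeval b :=
    MvPolynomial.algHom_ext fun i => by
      rw [AlgHom.comp_apply, poly, aeval_X, aeval_X]
      rfl
  simpa using DFunLike.congr_fun this p

theorem residue_eval_poly (b : Fin m → Ro K) (p : MvPolynomial (Fin m) (Ro K)) :
    residue _ (eval b (poly K m p)) =
      MvPolynomial.eval (residue _ ∘ b) (map (residue _) p) := by
  rw [eval_poly, map_eval]

theorem coe_eval (b : Fin m → Ro K) (p : MvPolynomial (Fin m) (Ro K)) :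
    (MvPolynomial.eval b p : K) =
      MvPolynomial.eval (fun i => (b i : K)) (map (Ro K).subtype p) :=
  map_eval (Ro K).subtype b p

theorem aeval_coordFn_apply (P : MvPolynomial (Fin m) K) (b : Fin m → Ro K) :
    (aeval (coordFn K m) P : UnitBall K m →ᵇ K) (UnitBall.mk b) =
      MvPolynomial.eval (fun i => (b i : K)) P := by
  induction P using MvPolynomial.induction_on with
  | C a => rw [eval_C, ← algebraMap_eq, AlgHom.commutes]; simp
  | add p q hp hq => rw [map_add, map_add, ← hp, ← hq]; rfl
  | mul_X p i hp => rw [map_mul, map_mul, ← hp, aeval_X, eval_X]; rfl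

theorem norm_eval_smul (r : Ro K) (f : TateAlgR K m) (b : Fin m → Ro K) :
    ‖(eval b (r • f) : K)‖ = ‖(r : K)‖ * ‖(eval b f : K)‖ := by
  rw [map_smul, smul_eq_mul, Subring.coe_mul, norm_mul]

theorem exists_eq_smul_of_norm_eval_le {r : Ro K} (hr : r ≠ 0) {f : TateAlgR K m}
    (h : ∀ b, ‖(eval b f : K)‖ ≤ ‖(r : K)‖) : ∃ g, f = r • g := by
  have hr' : (r : K) ≠ 0 := fun h => hr (Subtype.ext h)
  refine ⟨⟨(r : K)⁻¹ • f.1, Subalgebra.smul_mem _ f.2.1 _, ?_⟩, Subtype.ext ?_⟩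
  · refine norm_le_of_forall zero_le_one fun b => ?_
    rw [BoundedContinuousFunction.coe_smul, norm_smul, norm_inv]
    exact inv_mul_le_one_of_le₀ (h b) (norm_nonneg _)
  · exact (smul_inv_smul₀ hr' f.1).symm

theorem isClosed : IsClosed (TateAlgR K m : Set (UnitBall K m →ᵇ K)) :=
  isClosed_TateAlg.inter (isClosed_le continuous_norm continuous_const)

theorem exists_series [CompleteSpace K] {r : Ro K} (hr : ‖(r : K)‖ < 1) (a : ℕ → TateAlgR K m) :
    ∃ s : ℕ → TateAlgR K m, ∀ n, s n = a n + r • s (n + 1) := by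
  have hsum (n) : Summable fun i => (r : K) ^ i • (a (n + i)).1 := by
    refine .of_norm_bounded (summable_geometric_of_lt_one (norm_nonneg _) hr) fun i => ?_
    rw [norm_smul, norm_pow]
    exact mul_le_of_le_one_right (by positivity) (a (n + i)).2.2
  have hmem (n) : ∑' i, (r : K) ^ i • (a (n + i)).1 ∈ TateAlgR K m :=
    isClosed.mem_of_tendsto (hsum n).hasSum (.of_forall fun s => sum_mem fun i _ =>
      ((r ^ i) • a (n + i)).2)
  refine ⟨fun n => ⟨_, hmem n⟩, fun n => Subtype.ext ?_⟩
  calc ∑' i, (r : K) ^ i • (a (n + i)).1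
      = (a n).1 + ∑' i, (r : K) • (r : K) ^ i • (a (n + 1 + i)).1 := by
        rw [(hsum n).tsum_eq_zero_add]
        simp only [pow_succ', mul_smul, pow_zero, one_smul, add_zero, add_assoc, add_comm 1]
    _ = (a n).1 + (r : K) • ∑' i, (r : K) ^ i • (a (n + 1 + i)).1 := by
        rw [(hsum (n + 1)).tsum_const_smul]

section IsAlgClosed

variable [IsAlgClosed K]

theorem eq_of_forall_eval_residue {p q : MvPolynomial (Fin m) (ResidueField (Ro K))}
    (h : ∀ b : Fin m → Ro K, MvPolynomial.eval (residue _ ∘ b) p =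
      MvPolynomial.eval (residue _ ∘ b) q) : p = q :=
  MvPolynomial.funext (residue_surjective.comp_left.forall.2 h)

/-- A polynomial of supremum norm at most one has integral coefficients. -/
theorem exists_map_eq_of_norm_eval_le {P : MvPolynomial (Fin m) K}
    (hP : ∀ b : Fin m → Ro K, ‖MvPolynomial.eval (fun i => (b i : K)) P‖ ≤ 1) :
    ∃ p : MvPolynomial (Fin m) (Ro K), map (Ro K).subtype p = P := by
  by_cases h0 : P = 0
  · exact ⟨0, by simp [h0]⟩
  obtain ⟨i, hi, h⟩ := P.support.exists_max_image (fun j => ‖P.coeff j‖) (support_nonempty.2 h0)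
  have hc : P.coeff i ≠ 0 := mem_support_iff.1 hi
  obtain ⟨q, hq⟩ : C (P.coeff i)⁻¹ * P ∈ (map (σ := Fin m) (Ro K).subtype).range := by
    refine mem_range_map_iff_coeffs_subset.2 fun x hx => ?_
    obtain ⟨j, -, rfl⟩ := mem_coeffs_iff.1 hx
    refine ⟨⟨coeff j (C (P.coeff i)⁻¹ * P), ?_⟩, rfl⟩
    change ‖coeff j (C (P.coeff i)⁻¹ * P)‖ ≤ 1
    rw [coeff_C_mul, norm_mul, norm_inv]
    refine inv_mul_le_one_of_le₀ ?_ (norm_nonneg _)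
    by_cases hj : j ∈ P.support
    · exact h j hj
    · simp [notMem_support_iff.1 hj]
  have hPq : P = C (P.coeff i) * map (Ro K).subtype q := by
    rw [hq, ← mul_assoc, ← C_mul, mul_inv_cancel₀ hc, C_1, one_mul]
  have hq0 : map (residue _) q ≠ 0 := fun h0 => by
    have h1 : q.coeff i = 1 := Subtype.ext <| by
      have := congrArg (coeff i) hq
      rw [coeff_map, coeff_C_mul, inv_mul_cancel₀ hc] at this
      exact this
    have h2 := congrArg (coeff i) h0
    rw [coeff_map, h1] at h2
    simp at h2
  have hci : ‖P.coeff i‖ ≤ 1 := by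
    by_contra! hlt
    refine hq0 (eq_of_forall_eval_residue fun b => ?_)
    rw [map_zero, ← residue_eval_poly, Ro.residue_eq_zero_iff, eval_poly]
    have h1 := hP b
    rw [hPq, map_mul, eval_C, norm_mul, ← coe_eval] at h1
    by_contra! h3
    nlinarith
  exact ⟨C ⟨_, hci⟩ * q, by rw [map_mul, map_C]; exact hPq.symm⟩

theorem exists_norm_eval_sub_poly_lt (f : TateAlgR K m) {ε : ℝ} (hε : 0 < ε) (hε1 : ε ≤ 1) :
    ∃ p, ∀ b, ‖(eval b (f - poly K m p) : K)‖ < ε := by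
  obtain ⟨g, hg, hfg⟩ := Metric.mem_closure_iff.1 f.2.1 ε hε
  have hfg (b) : ‖f.1 (UnitBall.mk b) - g (UnitBall.mk b)‖ < ε := by
    rw [← dist_eq_norm]
    exact (BoundedContinuousFunction.dist_coe_le_dist _).trans_lt hfg
  rw [SetLike.mem_coe, Algebra.adjoin_range_eq_range_aeval] at hg
  obtain ⟨P, rfl⟩ := hg
  simp only [RingHom.coe_coe, AlgHom.toRingHom_eq_coe, aeval_coordFn_apply] at hfg
  obtain ⟨p, rfl⟩ := exists_map_eq_of_norm_eval_le (P := P) fun b => by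
    rw [← sub_sub_cancel (f.1 (UnitBall.mk b)) (MvPolynomial.eval _ P), sub_eq_add_neg]
    refine (IsUltrametricDist.norm_add_le_max _ _).trans (max_le (eval b f).2 ?_)
    rw [norm_neg]
    exact (hfg b).le.trans hε1
  refine ⟨p, fun b => ?_⟩
  have := hfg b
  rw [← coe_eval] at this
  rw [map_sub, eval_poly]
  exact this

theorem exists_red (f : TateAlgR K m) : ∃ q : MvPolynomial (Fin m) (ResidueField (Ro K)),
    ∀ b : Fin m → Ro K, MvPolynomial.eval (residue _ ∘ b) q = residue _ (eval b f) := by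
  obtain ⟨p, hp⟩ := exists_norm_eval_sub_poly_lt f one_pos le_rfl
  refine ⟨map (residue _) p, fun b => ?_⟩
  rw [← residue_eval_poly, eq_comm, ← sub_eq_zero, ← map_sub, ← map_sub]
  exact Ro.residue_eq_zero_iff.2 (hp b)

variable (K) in
/-- The reduction of strictly convergent power series of norm at most one. -/
def red (m : ℕ) : TateAlgR K m →ₐ[Ro K] MvPolynomial (Fin m) (ResidueField (Ro K)) where
  toFun f := (exists_red f).choose
  map_one' := eq_of_forall_eval_residue fun b => by
    rw [(exists_red 1).choose_spec b, map_one, map_one, map_one]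
  map_mul' f g := eq_of_forall_eval_residue fun b => by
    rw [(exists_red (f * g)).choose_spec b, map_mul, map_mul, map_mul,
      (exists_red f).choose_spec b, (exists_red g).choose_spec b]
  map_zero' := eq_of_forall_eval_residue fun b => by
    rw [(exists_red 0).choose_spec b, map_zero, map_zero, map_zero]
  map_add' f g := eq_of_forall_eval_residue fun b => by
    rw [(exists_red (f + g)).choose_spec b, map_add, map_add, map_add,
      (exists_red f).choose_spec b, (exists_red g).choose_spec b]
  commutes' r := eq_of_forall_eval_residue fun b => by
    rw [(exists_red (algebraMap _ _ r)).choose_spec b, AlgHom.commutes]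
    exact (eval_C _).symm

theorem eval_red (f : TateAlgR K m) (b : Fin m → Ro K) :
    MvPolynomial.eval (residue _ ∘ b) (red K m f) = residue _ (eval b f) :=
  (exists_red f).choose_spec b

theorem exists_eq_smul_red_ne_zero {f : TateAlgR K m} (hf : f ≠ 0) :
    ∃ (r : Ro K) (g : TateAlgR K m), f = r • g ∧ red K m g ≠ 0 := by
  obtain ⟨b₀, hb₀⟩ : ∃ b, eval b f ≠ 0 := by
    by_contra! h
    exact hf (ext_eval fun b => by rw [h, map_zero])
  have hpos : 0 < ‖(eval b₀ f : K)‖ := norm_pos_iff.2 fun h => hb₀ (Subtype.ext h)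
  obtain ⟨p, hp⟩ := exists_norm_eval_sub_poly_lt f hpos (eval b₀ f).2
  have hp0 : p ≠ 0 := by
    rintro rfl
    simpa using hp b₀
  obtain ⟨r, q, rfl, hq⟩ := exists_eq_C_mul_map_residue_ne_zero hp0
  rw [← smul_eq_C_mul, map_smul] at hp
  have hle (b) : ‖(eval b (r • poly K m q) : K)‖ ≤ ‖(r : K)‖ := by
    rw [norm_eval_smul]
    exact mul_le_of_le_one_right (norm_nonneg _) (eval b _).2
  have hmax (b) : ‖(eval b f : K)‖ ≤
      max ‖(eval b (f - r • poly K m q) : K)‖ ‖(eval b (r • poly K m q) : K)‖ := by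
    conv_lhs => rw [← sub_add_cancel f (r • poly K m q), map_add]
    exact IsUltrametricDist.norm_add_le_max _ _
  have hrle : ‖(eval b₀ f : K)‖ ≤ ‖(r : K)‖ :=
    ((le_max_iff.1 (hmax b₀)).resolve_left (hp b₀).not_ge).trans (hle b₀)
  have hr : r ≠ 0 := by
    rintro rfl
    exact hpos.not_ge (hrle.trans_eq norm_zero)
  obtain ⟨g, rfl⟩ := exists_eq_smul_of_norm_eval_le hr fun b =>
    (hmax b).trans (max_le ((hp b).le.trans hrle) (hle b))
  refine ⟨r, g, rfl, fun h => hq (eq_of_forall_eval_residue fun b => ?_)⟩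
  rw [← residue_eval_poly, ← h, eval_red, eq_comm, ← sub_eq_zero, ← map_sub, ← map_sub,
    Ro.residue_eq_zero_iff]
  have h1 := (hp b).trans_le hrle
  rw [← smul_sub, norm_eval_smul] at h1
  exact (mul_lt_iff_lt_one_right (hpos.trans_le hrle)).1 h1

variable (K) in
/-- The ring `R⟨S₁,…,Sₘ⟩` with its polynomials, reduction and completeness. -/
def model [CompleteSpace K] (m : ℕ) : TateModel (Ro K) m (TateAlgR K m) where
  poly := poly K m
  red := red K m
  red_poly p := eq_of_forall_eval_residue fun b => by rw [eval_red, residue_eval_poly]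
  smul_eq_zero r f h hr := ext_eval fun b => by
    have := congrArg (eval b) h
    rw [map_smul, map_zero, smul_eq_mul] at this
    rw [(mul_eq_zero.1 this).resolve_left hr, map_zero]
  exists_eq_smul _ hf := exists_eq_smul_red_ne_zero hf
  exists_poly_add r f hr := by
    obtain ⟨p, hp⟩ := exists_norm_eval_sub_poly_lt f
      (norm_pos_iff.2 fun h => hr (Subtype.ext h)) r.2
    obtain ⟨g, hg⟩ := exists_eq_smul_of_norm_eval_le hr fun b => (hp b).le
    exact ⟨p, g, by rw [← hg]; ring⟩
  exists_series r a hr := exists_series (by simpa [Ro.isUnit_iff] using hr) a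
  separated r a hr h := ext_eval fun b => by
    have hr : ‖(r : K)‖ < 1 := by simpa [Ro.isUnit_iff] using hr
    have hle (n) : ‖(eval b (a 0) : K)‖ ≤ ‖(r : K)‖ ^ n := by
      have : a 0 = r ^ n • a n := by
        induction n with
        | zero => simp
        | succ n ih => rw [ih, h n, smul_smul, pow_succ]
      rw [this, norm_eval_smul, Subring.coe_pow, norm_pow]
      exact mul_le_of_le_one_right (by positivity) (eval b (a n)).2
    have h0 := ge_of_tendsto' (tendsto_pow_atTop_nhds_zero_of_lt_one (norm_nonneg _) hr) hle
    rw [map_zero]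
    exact Subtype.ext (norm_le_zero_iff.1 h0)

/-- Substitution of power series of norm at most one. -/
theorem exists_subst (t : Fin n → TateAlgR K m) : ∃ θ : TateAlgR K n →ₐ[Ro K] TateAlgR K m,
    ∀ f, red K m (θ f) = aeval (fun i => red K m (t i)) (red K n f) := by
  let τ : C(UnitBall K m, UnitBall K n) :=
    ⟨fun x => ⟨fun i => (t i).1 x, fun i => ((t i).1.norm_coe_le_norm x).trans (t i).2.2⟩,
      (continuous_pi fun i => (t i).1.continuous).subtype_mk _⟩
  have hmem : TateAlg K n ≤ (TateAlg K m).comap (pull τ) := by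
    refine Subalgebra.topologicalClosure_minimal (Algebra.adjoin_le ?_)
      (isClosed_TateAlg.preimage (continuous_pull τ))
    rintro _ ⟨i, rfl⟩
    exact (t i).2.1
  let θ : TateAlgR K n →ₐ[Ro K] TateAlgR K m :=
    { toFun := fun f => ⟨pull τ f.1, hmem f.2.1, norm_le_of_forall zero_le_one fun b =>
        (f.1.norm_coe_le_norm _).trans f.2.2⟩
      map_one' := rfl
      map_mul' := fun _ _ => rfl
      map_zero' := rfl
      map_add' := fun _ _ => rfl
      commutes' := fun _ => rfl }
  refine ⟨θ, fun f => eq_of_forall_eval_residue fun b => ?_⟩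
  have h1 : eval b (θ f) = eval (fun i => eval b (t i)) f := rfl
  have h2 : residue _ ∘ (fun i => eval b (t i)) =
      fun i => MvPolynomial.eval (residue _ ∘ b) (red K m (t i)) := by
    funext i
    rw [eval_red]
    rfl
  rw [eval_red, h1, ← eval_red, h2, ← aeval_eq_eval, ← aeval_eq_eval]
  exact (comp_aeval_apply _ _ _).symm

end IsAlgClosed

end TateAlgR

end TateAlgebra

/-- The lifting property over a non-trivially valued field. -/
theorem exists_lift_of_isDomain {K : Type} [NormedField K] [CompleteSpace K] [IsAlgClosed K]
    [IsUltrametricDist K] (hR : ¬ IsField (Ro K)) {D : Type} [CommRing D] [IsDomain D]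
    [Algebra (Ro K) D] (hD : IsTopFinType K D) (hinj : Function.Injective (algebraMap (Ro K) D))
    (y : D →ₐ[Ro K] ResidueField (Ro K)) :
    ∃ z : D →ₐ[Ro K] Ro K, ∀ x, residue _ (z x) = y x := by
  obtain ⟨m, ψ, hψ⟩ := hD
  obtain ⟨n, χ, hχ, hfin⟩ := (TateAlgR.model K m).exists_finite_injective hR _ (TateAlgR.model K)
    (fun n t => TateAlgR.exists_subst t) ψ hψ (fun r x h hr => by
      rw [Algebra.smul_def] at h
      exact (mul_eq_zero.1 h).resolve_left fun h0 => hr (hinj (h0.trans (map_zero _).symm))) y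
  refine (TateAlgR.model K n).exists_lift_of_finite hR (fun p hp => Ro.splits hp)
    (fun b => ⟨TateAlgR.eval b, fun i => ?_⟩) χ hχ hfin y
  exact (TateAlgR.eval_poly b _).trans (eval_X i)

theorem exists_lift_comp_eq {K : Type} [NormedField K] [CompleteSpace K] [IsAlgClosed K]
    [IsUltrametricDist K] {A B : Type} [CommRing A] [CommRing B] [Algebra (Ro K) A]
    [Algebra (Ro K) B] (hB : IsTopFinType K B) (φ : A →ₐ[Ro K] B) (hφ : φ.toRingHom.Flat)
    (x : A →ₐ[Ro K] Ro K) (y : B →ₐ[Ro K] ResidueField (Ro K))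
    (hxy : ∀ a, y (φ a) = residue _ (x a)) :
    ∃ z : B →ₐ[Ro K] Ro K, z.comp φ = x ∧ ∀ b, residue _ (z b) = y b := by
  by_cases hR : IsField (Ro K)
  · have hbij : Function.Bijective (algebraMap (Ro K) (ResidueField (Ro K))) := by
      let _ := hR.toField
      exact ⟨(algebraMap (Ro K) (ResidueField (Ro K))).injective, residue_surjective⟩
    let E := AlgEquiv.ofBijective (Algebra.ofId (Ro K) (ResidueField (Ro K))) hbij
    have hE (b) : residue _ (E.symm (y b)) = y b := E.apply_symm_apply _
    refine ⟨E.symm.toAlgHom.comp y, AlgHom.ext fun a => hbij.1 ?_, hE⟩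
    exact (hE _).trans (hxy a)
  · let _ : Algebra A B := φ.toRingHom.toAlgebra
    have : Module.Flat A B := hφ
    have := RingHom.ker_isPrime x
    have := RingHom.ker_isPrime y
    have : (RingHom.ker y).LiesOver ((RingHom.ker y).under A) := inferInstance
    obtain ⟨P, hPQ, hP, hPover⟩ := Ideal.exists_ideal_le_liesOver_of_le (p := RingHom.ker x)
      (q := (RingHom.ker y).under A) (RingHom.ker y) fun a ha => by
        change y (φ a) = 0
        rw [hxy, show x a = 0 from ha, map_zero]
    have hPmem (a) : φ a ∈ P ↔ x a = 0 := by
      change a ∈ P.under A ↔ _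
      rw [← hPover.over]
      rfl
    obtain ⟨m, ψ, hψ⟩ := hB
    have hinj : Function.Injective (algebraMap (Ro K) (B ⧸ P)) := by
      refine (injective_iff_map_eq_zero _).2 fun r hr => ?_
      have h1 := Ideal.Quotient.eq_zero_iff_mem.1
        (show Ideal.Quotient.mk P (algebraMap (Ro K) B r) = 0 from hr)
      rw [← φ.commutes, hPmem] at h1
      simpa using h1
    obtain ⟨z, hz⟩ := exists_lift_of_isDomain hR
      ⟨m, (Ideal.Quotient.mkₐ _ P).comp ψ, Ideal.Quotient.mk_surjective.comp hψ⟩ hinj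
      (Ideal.Quotient.liftₐ P y hPQ)
    refine ⟨z.comp (Ideal.Quotient.mkₐ _ P), AlgHom.ext fun a => ?_, fun b => hz _⟩
    have h1 : Ideal.Quotient.mk P (φ a) = algebraMap (Ro K) (B ⧸ P) (x a) := by
      refine Ideal.Quotient.eq.2 ?_
      rw [← φ.commutes, ← map_sub, hPmem]
      simp
    exact (congrArg z h1).trans (z.commutes _)

end RigidQE
end

noncomputable section
namespace RigidQE

/-- **Flat Lifting Lemma.**  Let `A° → B°` be a flat morphism of `R`-flat `R`-algebras
topologically of finite type.  Let `x° : Spec R → Spec A°` be an `R`-rational point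
(equivalently, an `R`-algebra morphism `A° → R`) with reduction `x̄ : Spec K̄ → Spec A°`,
and suppose `ȳ : Spec K̄ → Spec B°` is a `K̄`-rational point with `f ∘ ȳ = x̄`.  Then
there is an `R`-rational point `y° : Spec R → Spec B°` with reduction `ȳ` and
`f ∘ y° = x°`. -/
theorem flat_lifting_lemma
    (K : Type) [NormedField K] [CompleteSpace K] [IsAlgClosed K] [IsUltrametricDist K]
    (A B : Type) [CommRing A] [CommRing B] [Algebra (Ro K) A] [Algebra (Ro K) B]
    (hA : IsTopFinType K A) (hB : IsTopFinType K B)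
    (hAflat : Module.Flat (Ro K) A) (hBflat : Module.Flat (Ro K) B)
    (φ : A →ₐ[Ro K] B) (hφ : RingHom.Flat φ.toRingHom)
    (x : A →ₐ[Ro K] Ro K)
    (ybar : B →ₐ[Ro K] (Ro K ⧸ RoMax K))
    (hcomm : ybar.comp φ = (Ideal.Quotient.mkₐ (Ro K) (RoMax K)).comp x) :
    ∃ y : B →ₐ[Ro K] Ro K,
      y.comp φ = x ∧ (Ideal.Quotient.mkₐ (Ro K) (RoMax K)).comp y = ybar := by
  let e : (Ro K ⧸ RoMax K) ≃ₐ[Ro K] IsLocalRing.ResidueField (Ro K) :=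
    Ideal.quotientEquivAlgOfEq (Ro K) RoMax_eq_maximalIdeal
  obtain ⟨y, hy, hres⟩ := exists_lift_comp_eq hB φ hφ x (e.toAlgHom.comp ybar) fun a =>
    congrArg e (DFunLike.congr_fun hcomm a)
  exact ⟨y, hy, AlgHom.ext fun b => e.injective (hres b)⟩

end RigidQE
end
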